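/- arXiv:2203.07891 — 3 statements merged into one kernel-verified Lean document; each statement's English description precedes it below -/
import Mathlib

section
/- Let k(t,s) = (1/6)(3t²s − t³) for s ≥ t and k(t,s) = (1/6)(3s²t − s³) for s ≤ t, on [0,1] × [0,1]. Then 0 ≤ k(t,s) ≤ 1, 0 ≤ ∂k/∂t(t,s) ≤ 1 and 0 ≤ ∂²k/∂t²(t,s) ≤ 1 for all (t,s) ∈ [0,1] × [0,1]. -/
open Set

/-- The Green's function for the cantilever beam problem:
`k(t,s) = (1/6)(3t²s − t³)` for `s ≥ t` and `k(t,s) = (1/6)(3s²t − s³)` for `s ≤ t`. -/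
noncomputable def kern (t s : ℝ) : ℝ :=
  if t ≤ s then (3 * t ^ 2 * s - t ^ 3) / 6 else (3 * s ^ 2 * t - s ^ 3) / 6

/-- Two differentiable functions whose values and derivatives agree at `s` glue to a
differentiable function. -/
theorem hasDerivAt_ite_le {f g f' g' : ℝ → ℝ} {s : ℝ} (hf : ∀ x, HasDerivAt f (f' x) x)
    (hg : ∀ x, HasDerivAt g (g' x) x) (h : f s = g s) (h' : f' s = g' s) (t : ℝ) :
    HasDerivAt (fun x => if x ≤ s then f x else g x) (if t ≤ s then f' t else g' t) t := by
  rcases lt_trichotomy t s with hts | rfl | hts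
  · rw [if_pos hts.le]
    refine (hf t).congr_of_eventuallyEq ?_
    filter_upwards [Iio_mem_nhds hts] with x hx
    exact if_pos (le_of_lt hx)
  · rw [if_pos le_rfl]
    have hl : HasDerivWithinAt (fun x => if x ≤ t then f x else g x) (f' t) (Iic t) t :=
      (hf t).hasDerivWithinAt.congr (fun x hx => if_pos hx) (if_pos le_rfl)
    have hr : HasDerivWithinAt (fun x => if x ≤ t then f x else g x) (f' t) (Ici t) t := by
      rw [h']
      refine (hg t).hasDerivWithinAt.congr (fun x hx => ?_) (by simp [h])
      rcases eq_or_lt_of_le (mem_Ici.1 hx) with rfl | hx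
      · simp [h]
      · exact if_neg hx.not_ge
    simpa using hl.union hr
  · rw [if_neg hts.not_ge]
    refine (hg t).congr_of_eventuallyEq ?_
    filter_upwards [Ioi_mem_nhds hts] with x hx
    exact if_neg (not_le.2 hx)

theorem deriv_kern (s : ℝ) :
    deriv (fun x => kern x s) = fun t => if t ≤ s then t * s - t ^ 2 / 2 else s ^ 2 / 2 := by
  funext t
  refine (hasDerivAt_ite_le (f := fun x => (3 * x ^ 2 * s - x ^ 3) / 6)
    (g := fun x => (3 * s ^ 2 * x - s ^ 3) / 6) (f' := fun x => x * s - x ^ 2 / 2)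
    (g' := fun _ => s ^ 2 / 2) (fun x => ?_) (fun x => ?_) (by ring) (by ring) t).deriv
  · exact (((((hasDerivAt_pow 2 x).const_mul 3).mul_const s).sub
      (hasDerivAt_pow 3 x)).div_const 6).congr_deriv (by norm_num; ring)
  · exact ((((hasDerivAt_id x).const_mul (3 * s ^ 2)).sub_const (s ^ 3)).div_const 6).congr_deriv
      (by ring)

theorem deriv_deriv_kern (s : ℝ) :
    deriv^[2] (fun x => kern x s) = fun t => if t ≤ s then s - t else 0 := by
  change deriv (deriv fun x => kern x s) = _
  rw [deriv_kern]
  funext t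
  refine (hasDerivAt_ite_le (f := fun x => x * s - x ^ 2 / 2) (g := fun _ => s ^ 2 / 2)
    (f' := fun x => s - x) (g' := fun _ => 0) (fun x => ?_)
    (fun x => hasDerivAt_const x _) (by ring) (by ring) t).deriv
  exact (((hasDerivAt_id x).mul_const s).sub ((hasDerivAt_pow 2 x).div_const 2)).congr_deriv
    (by norm_num)

/-- On `[0,1] × [0,1]` one has `0 ≤ k(t,s) ≤ 1`, `0 ≤ ∂k/∂t(t,s) ≤ 1` and
`0 ≤ ∂²k/∂t²(t,s) ≤ 1`. -/
theorem kern_derivative_bounds :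
    ∀ t ∈ Icc (0:ℝ) 1, ∀ s ∈ Icc (0:ℝ) 1,
      0 ≤ kern t s ∧ kern t s ≤ 1 ∧
      0 ≤ deriv (fun x => kern x s) t ∧ deriv (fun x => kern x s) t ≤ 1 ∧
      0 ≤ deriv^[2] (fun x => kern x s) t ∧ deriv^[2] (fun x => kern x s) t ≤ 1 := by
  rintro t ⟨ht0, ht1⟩ s ⟨hs0, hs1⟩
  rw [deriv_deriv_kern, deriv_kern, kern]
  have hs2 : s ^ 2 ≤ 1 := pow_le_one₀ hs0 hs1
  have ht2 : t ^ 2 ≤ 1 := pow_le_one₀ ht0 ht1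
  have hs3 : 0 ≤ s ^ 3 := by positivity
  have ht3 : 0 ≤ t ^ 3 := by positivity
  have hts : t * s ≤ 1 := mul_le_one₀ ht1 hs0 hs1
  have ht2s : t ^ 2 * s ≤ 1 := mul_le_one₀ ht2 hs0 hs1
  have hs2t : s ^ 2 * t ≤ 1 := mul_le_one₀ hs2 ht0 ht1
  dsimp only
  split_ifs with h
  · have h1 : 0 ≤ t * (s - t) := mul_nonneg ht0 (sub_nonneg.2 h)
    have h2 : 0 ≤ t ^ 2 * (s - t) := mul_nonneg (sq_nonneg t) (sub_nonneg.2 h)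
    refine ⟨?_, ?_, ?_, ?_, ?_, ?_⟩ <;> nlinarith
  · have h1 : 0 ≤ s ^ 2 * (t - s) := mul_nonneg (sq_nonneg s) (sub_nonneg.2 (not_le.1 h).le)
    refine ⟨?_, ?_, ?_, ?_, ?_, ?_⟩ <;> nlinarith
end

section
/- (Birkhoff–Kellogg type theorem of Krasnosel'skiĭ and Ladyženskiĭ.) Let (X, ‖·‖) be a real Banach space, U ⊆ X an open bounded set with 0 ∈ U, K ⊆ X a cone, and T : K ∩ cl(U) → K a compact (i.e. continuous with relatively compact image) map such that inf_{x ∈ K ∩ ∂U} ‖Tx‖ > 0. Then there exist λ₀ ∈ (0, +∞) and x₀ ∈ K ∩ ∂U such that x₀ = λ₀ T x₀. -/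
open Set

namespace KuhnGrid

/-- The `m`-th vertex of the (possibly degenerate) simplex of the unit grid encoded by `x`. -/
def vertex {d : ℕ} (x : Fin d → ℕ) (m : ℕ) : Fin d → ℕ := fun i => (x i + m) / (d + 1)

/-- Codes of the simplices in the face of the grid on which the coordinates from `k` on
are maximal. -/
def faceBox (d N k : ℕ) : Finset (Fin d → ℕ) :=
  {x ∈ Fintype.piFinset fun _ => Finset.range ((d + 1) * N + 1) |
    ∀ i : Fin d, if (i : ℕ) < k then x i < (d + 1) * N else x i = (d + 1) * N}

/-- Exchanges the residues `-(j + 1)` and `-(j + 2)` modulo `M`. -/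
def exchange (M j x : ℕ) : ℕ :=
  if M ∣ x + j + 1 then x - 1 else if M ∣ x + j + 2 then x + 1 else x

lemma mem_faceBox {d N k : ℕ} {x : Fin d → ℕ} : x ∈ faceBox d N k ↔
    ∀ i : Fin d, if (i : ℕ) < k then x i < (d + 1) * N else x i = (d + 1) * N := by
  simp only [faceBox, Finset.mem_filter, Fintype.mem_piFinset, Finset.mem_range,
    and_iff_right_iff_imp]
  intro h i
  have := h i
  split_ifs at this <;> omega

lemma succ_div_of_not_dvd {M a : ℕ} (h : ¬ M ∣ a + 1) : (a + 1) / M = a / M := by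
  rw [Nat.succ_div, if_neg h, add_zero]

lemma not_dvd_add {M a b c : ℕ} (h : M ∣ a + b) (hb : b < M) (hc : c < M) (hbc : b ≠ c) :
    ¬ M ∣ a + c := by
  intro h'
  rcases lt_or_gt_of_ne hbc with hlt | hlt
  · have := Nat.le_of_dvd (by omega) ((Nat.dvd_add_right h).1
      (show M ∣ (a + b) + (c - b) by rwa [show a + b + (c - b) = a + c by omega]))
    omega
  · have := Nat.le_of_dvd (by omega) ((Nat.dvd_add_right h').1
      (show M ∣ (a + c) + (b - c) by rwa [show a + c + (b - c) = a + b by omega]))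
    omega

lemma exchange_add_div {M j m x : ℕ} (hj : j + 2 < M) (hm : m < M) (hmj : m ≠ j + 1) :
    (exchange M j x + m) / M = (x + m) / M := by
  unfold exchange
  split_ifs with h1 h2
  · have hx : x ≠ 0 := by
      rintro rfl
      have := Nat.le_of_dvd (by omega) h1
      omega
    obtain ⟨y, rfl⟩ := Nat.exists_eq_succ_of_ne_zero hx
    have := not_dvd_add (b := j + 1) (c := m) h1 (by omega) hm (Ne.symm hmj)
    rw [show y.succ - 1 + m = y + m by omega, show y.succ + m = y + m + 1 by omega,
      succ_div_of_not_dvd (by rwa [show y + m + 1 = y.succ + m by omega])]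
  · rw [show x + 1 + m = x + m + 1 by omega, succ_div_of_not_dvd]
    have := not_dvd_add (a := x) (b := j + 2) (c := m + 1) h2 (by omega)
    by_cases hM : m + 1 < M
    · exact this hM (by omega)
    · intro h3
      have : M ∣ x + M := by rwa [show x + M = x + m + 1 by omega]
      have h4 : M ∣ x + 0 := by simpa using this
      exact not_dvd_add h4 (by omega) hj (by omega) h2
  · rfl

lemma exchange_exchange {M j x : ℕ} (hj : j + 2 < M) : exchange M j (exchange M j x) = x := by
  have key : ∀ y, M ∣ y + j + 2 → ¬ M ∣ y + j + 1 := fun y h =>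
    not_dvd_add (a := y) (b := j + 2) (c := j + 1) h hj (by omega) (by omega)
  by_cases h1 : M ∣ x + j + 1
  · have hx : x ≠ 0 := by
      rintro rfl
      have := Nat.le_of_dvd (by omega) h1
      omega
    have h2 : M ∣ x - 1 + j + 2 := by rwa [show x - 1 + j + 2 = x + j + 1 by omega]
    simp only [exchange, if_pos h1, if_pos h2, if_neg (key _ h2)]
    omega
  · by_cases h2 : M ∣ x + j + 2
    · have h3 : M ∣ x + 1 + j + 1 := by rwa [show x + 1 + j + 1 = x + j + 2 by omega]
      simp only [exchange, if_neg h1, if_pos h2, if_pos h3]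
      omega
    · simp only [exchange, if_neg h1, if_neg h2]

lemma exchange_mem_faceBox {d N k j : ℕ} (hj : j + 2 < d + 1) {x : Fin d → ℕ}
    (hx : x ∈ faceBox d N k) : (fun i => exchange (d + 1) j (x i)) ∈ faceBox d N k := by
  rw [mem_faceBox] at hx ⊢
  have h0 : (d + 1) ∣ (d + 1) * N + 0 := ⟨N, rfl⟩
  have hL1 : ¬ (d + 1) ∣ (d + 1) * N + j + 1 :=
    not_dvd_add (c := j + 1) h0 (by omega) (by omega) (by omega)
  have hL2 : ¬ (d + 1) ∣ (d + 1) * N + j + 2 :=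
    not_dvd_add (c := j + 2) h0 (by omega) (by omega) (by omega)
  intro i
  have hi := hx i
  split_ifs at hi ⊢
  · unfold exchange
    split_ifs with h1 h2
    · omega
    · rcases Nat.lt_or_ge (x i + 1) ((d + 1) * N) with h | h
      · exact h
      · refine absurd h2 ?_
        rwa [show x i + j + 2 = (d + 1) * N + j + 1 by omega]
    · exact hi
  · rw [hi, exchange, if_neg hL1, if_neg hL2]

variable {d : ℕ} (lam : ℕ → (Fin d → ℕ) → ZMod 2)

/-- The part of the product of label differences that interpolates between the faces opposite
to the last and to the first vertex. -/
def mixedProd (k j : ℕ) (x : Fin d → ℕ) : ZMod 2 :=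
  (∏ i ∈ Finset.range j, (lam i (vertex x (i + 1)) + lam i (vertex x i))) *
    ∏ i ∈ Finset.Ico j k, (lam i (vertex x (i + 2)) + lam i (vertex x (i + 1)))

lemma mixedProd_add_mixedProd_succ {k j : ℕ} (hjk : j < k) (x : Fin d → ℕ) :
    mixedProd lam k j x + mixedProd lam k (j + 1) x =
      (∏ i ∈ Finset.range j, (lam i (vertex x (i + 1)) + lam i (vertex x i))) *
      (lam j (vertex x (j + 2)) + lam j (vertex x j)) *
      ∏ i ∈ Finset.Ico (j + 1) k, (lam i (vertex x (i + 2)) + lam i (vertex x (i + 1))) := by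
  unfold mixedProd
  rw [Finset.prod_range_succ, Finset.prod_eq_prod_Ico_succ_bot hjk]
  linear_combination (∏ i ∈ Finset.range j, (lam i (vertex x (i + 1)) + lam i (vertex x i))) *
    (∏ i ∈ Finset.Ico (j + 1) k, (lam i (vertex x (i + 2)) + lam i (vertex x (i + 1)))) *
    CharTwo.add_self_eq_zero (lam j (vertex x (j + 1)))

lemma sum_mixedProd_succ {N k j : ℕ} (hjk : j < k) (hkd : k < d) :
    ∑ x ∈ faceBox d N (k + 1), mixedProd lam k j x * lam k (vertex x (k + 1)) =
      ∑ x ∈ faceBox d N (k + 1), mixedProd lam k (j + 1) x * lam k (vertex x (k + 1)) := by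
  rw [← CharTwo.add_eq_zero, ← Finset.sum_add_distrib]
  have hv : ∀ (x : Fin d → ℕ) m, m < d + 1 → m ≠ j + 1 →
      vertex (fun i => exchange (d + 1) j (x i)) m = vertex x m := fun x m hm hmj =>
    funext fun i => exchange_add_div (by omega) hm hmj
  simp_rw [← add_mul, mixedProd_add_mixedProd_succ lam hjk]
  refine Finset.sum_involution (fun x _ i => exchange (d + 1) j (x i)) ?_ ?_
    (fun x hx => exchange_mem_faceBox (by omega) hx)
    (fun x _ => funext fun i => exchange_exchange (by omega))
  · intro x _
    rw [CharTwo.add_eq_zero]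
    rw [hv x (j + 2) (by omega) (by omega), hv x j (by omega) (by omega),
      hv x (k + 1) (by omega) (by omega)]
    congr 2
    · congr 1
      refine Finset.prod_congr rfl fun i hi => ?_
      rw [Finset.mem_range] at hi
      rw [hv x (i + 1) (by omega) (by omega), hv x i (by omega) (by omega)]
    · refine Finset.prod_congr rfl fun i hi => ?_
      rw [Finset.mem_Ico] at hi
      rw [hv x (i + 2) (by omega) (by omega), hv x (i + 1) (by omega) (by omega)]
  · intro x _ hne heq
    apply hne
    have : vertex x (j + 2) = vertex x j := by
      funext i
      have hi : exchange (d + 1) j (x i) = x i := congrFun heq i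
      unfold exchange at hi
      unfold vertex
      have hx : (d + 1) ∣ x i + j + 1 → x i ≠ 0 := by
        intro h hx
        rw [hx] at h
        have := Nat.le_of_dvd (by omega) h
        omega
      split_ifs at hi with h1 h2
      · have := hx h1
        omega
      · omega
      · rw [show x i + (j + 2) = x i + j + 1 + 1 by omega,
          succ_div_of_not_dvd (a := x i + j + 1) h2, succ_div_of_not_dvd h1]
    rw [this, CharTwo.add_self_eq_zero]
    simp

lemma sum_mixedProd {N k j : ℕ} (hjk : j ≤ k) (hkd : k < d) :
    ∑ x ∈ faceBox d N (k + 1), mixedProd lam k j x * lam k (vertex x (k + 1)) =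
      ∑ x ∈ faceBox d N (k + 1), mixedProd lam k 0 x * lam k (vertex x (k + 1)) := by
  induction j with
  | zero => rfl
  | succ j ih => rw [← sum_mixedProd_succ lam (by omega) hkd, ih (by omega)]

/-- The product of the label differences along the first `k` edges. -/
def edgeProd (k : ℕ) (x : Fin d → ℕ) : ZMod 2 :=
  ∏ i ∈ Finset.range k, (lam i (vertex x (i + 1)) + lam i (vertex x i))

lemma sum_edgeProd_succ {N k : ℕ} (hN : 0 < N) (hkd : k < d)
    (h0 : ∀ (i : Fin d) p, p i = 0 → lam i p = 0) (h1 : ∀ (i : Fin d) p, p i = N → lam i p = 1) :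
    ∑ x ∈ faceBox d N (k + 1), edgeProd lam (k + 1) x = ∑ x ∈ faceBox d N k, edgeProd lam k x := by
  set L := (d + 1) * N with hL
  have hLpos : 0 < L := by positivity
  have hlow : ∀ (x : Fin d → ℕ) i m, m < d + 1 → x i = 0 → vertex x m i = 0 := by
    intro x i m hm hx
    simp [vertex, hx, Nat.div_eq_of_lt hm]
  have hhigh : ∀ (x : Fin d → ℕ) i m, m < d + 1 → x i = L → vertex x m i = N := by
    intro x i m hm hx
    simp only [vertex, hx, hL]
    rw [Nat.mul_add_div (by omega), Nat.div_eq_of_lt hm, add_zero]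
  let W : (Fin d → ℕ) → ZMod 2 := fun y => edgeProd lam k y * lam k (vertex y k)
  let sh : (Fin d → ℕ) → Fin d → ℕ := fun x i => if (i : ℕ) < k + 1 then x i + 1 else x i
  have hvert : ∀ x ∈ faceBox d N (k + 1), ∀ m ≤ k, vertex (sh x) m = vertex x (m + 1) := by
    intro x hx m hm
    funext i
    have hxi := mem_faceBox.1 hx i
    by_cases hi : (i : ℕ) < k + 1
    · simp only [vertex, sh, if_pos hi]
      congr 1
      omega
    · rw [if_neg hi] at hxi
      rw [hhigh x i (m + 1) (by omega) hxi, hhigh _ i m (by omega)]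
      simp only [sh, if_neg hi, hxi, hL]
  let A : Finset (Fin d → ℕ) := {y ∈ Fintype.piFinset fun _ => Finset.range (L + 1) |
    ∀ i : Fin d, if (i : ℕ) < k + 1 then 0 < y i else y i = L}
  have hA : ∀ y, y ∈ A ↔ ∀ i : Fin d, if (i : ℕ) < k + 1 then 0 < y i ∧ y i ≤ L else y i = L := by
    intro y
    simp only [A, Finset.mem_filter, Fintype.mem_piFinset, Finset.mem_range, ← forall_and]
    refine forall_congr' fun i => ?_
    split_ifs <;> omega
  have hshift : ∑ x ∈ faceBox d N (k + 1), mixedProd lam k 0 x * lam k (vertex x (k + 1)) =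
      ∑ y ∈ A, W y := by
    refine Finset.sum_bij' (fun x _ => sh x)
      (fun y _ i => if (i : ℕ) < k + 1 then y i - 1 else y i) ?_ ?_ ?_ ?_ ?_
    · intro x hx
      rw [hA]
      intro i
      have hxi := mem_faceBox.1 hx i
      simp only [sh]
      split_ifs at hxi ⊢ <;> omega
    · intro y hy
      rw [mem_faceBox]
      intro i
      have hyi := (hA y).1 hy i
      split_ifs at hyi ⊢ <;> omega
    · intro x hx
      funext i
      simp only [sh]
      split_ifs <;> omega
    · intro y hy
      funext i
      have hyi := (hA y).1 hy i
      simp only [sh]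
      split_ifs at hyi ⊢ <;> omega
    · intro x hx
      simp only [W, mixedProd, edgeProd, Finset.range_zero, Finset.prod_empty, one_mul,
        ← Finset.range_eq_Ico]
      rw [hvert x hx k le_rfl]
      congr 1
      refine Finset.prod_congr rfl fun i hi => ?_
      rw [Finset.mem_range] at hi
      rw [hvert x hx i hi.le, hvert x hx (i + 1) hi]
  have hsplit : ∑ x ∈ faceBox d N (k + 1), edgeProd lam (k + 1) x =
      ∑ y ∈ A, W y + ∑ y ∈ faceBox d N (k + 1), W y := by
    rw [← hshift, ← sum_mixedProd lam le_rfl hkd, ← Finset.sum_add_distrib]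
    refine Finset.sum_congr rfl fun x _ => ?_
    simp only [W, mixedProd, edgeProd, Finset.prod_range_succ, Finset.Ico_self,
      Finset.prod_empty]
    ring
  rw [hsplit]
  let F : Finset (Fin d → ℕ) := Fintype.piFinset fun _ => Finset.range (L + 1)
  have hAF : A ⊆ F := Finset.filter_subset _ _
  have hBF : ∀ k, faceBox d N k ⊆ F := fun k => Finset.filter_subset _ _
  rw [← Finset.inter_eq_right.2 hAF, ← Finset.inter_eq_right.2 (hBF (k + 1)),
    ← Finset.inter_eq_right.2 (hBF k), ← Finset.sum_ite_mem, ← Finset.sum_ite_mem,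
    ← Finset.sum_ite_mem, ← Finset.sum_add_distrib]
  refine Finset.sum_congr rfl fun y _ => ?_
  have hzero : ∀ i : Fin d, (i : ℕ) < k → y i = 0 ∨ y i = L → edgeProd lam k y = 0 := by
    intro i hik hy
    refine Finset.prod_eq_zero (Finset.mem_range.2 hik) ?_
    rcases hy with hy | hy
    · rw [h0 i _ (hlow y i _ (by omega) hy), h0 i _ (hlow y i _ (by omega) hy), add_zero]
    · rw [h1 i _ (hhigh y i _ (by omega) hy), h1 i _ (hhigh y i _ (by omega) hy),
        CharTwo.add_self_eq_zero]
  by_cases hE : edgeProd lam k y = 0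
  · simp [W, hE]
  have hmid : ∀ i : Fin d, (i : ℕ) < k → y i ≠ 0 ∧ y i ≠ L := fun i hi =>
    ⟨fun h => hE (hzero i hi (Or.inl h)), fun h => hE (hzero i hi (Or.inr h))⟩
  let i₀ : Fin d := ⟨k, hkd⟩
  by_cases hy0 : y i₀ = 0
  · have hW : W y = 0 := by
      simp only [W]
      rw [h0 i₀ _ (hlow y i₀ _ (by omega) hy0), mul_zero]
    have hB : y ∉ faceBox d N k := by
      intro h
      have := mem_faceBox.1 h i₀
      simp only [i₀, lt_irrefl, if_false] at this hy0
      omega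
    simp [hW, hB]
  by_cases hyL : y i₀ = L
  · have hW : W y = edgeProd lam k y := by
      simp only [W]
      rw [h1 i₀ _ (hhigh y i₀ _ (by omega) hyL), mul_one]
    have hB : y ∉ faceBox d N (k + 1) := by
      intro h
      have := mem_faceBox.1 h i₀
      simp only [i₀, Nat.lt_succ_self, if_true] at this hyL
      omega
    have hAB : y ∈ A ↔ y ∈ faceBox d N k := by
      rw [hA, mem_faceBox]
      refine forall_congr' fun i => ?_
      rcases lt_trichotomy (i : ℕ) k with h | h | h
      · have := hmid i h
        rw [if_pos (by omega), if_pos h]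
        omega
      · have : i = i₀ := Fin.ext h
        subst this
        rw [if_pos (by omega), if_neg (by omega)]
        omega
      · rw [if_neg (by omega), if_neg (by omega)]
    simp [hW, hB, hAB]
  · have hB : y ∉ faceBox d N k := by
      intro h
      have := mem_faceBox.1 h i₀
      simp only [i₀, lt_irrefl, if_false] at this hyL
      omega
    have hAB : y ∈ A ↔ y ∈ faceBox d N (k + 1) := by
      rw [hA, mem_faceBox]
      refine forall_congr' fun i => ?_
      rcases lt_trichotomy (i : ℕ) k with h | h | h
      · have := hmid i h
        rw [if_pos (by omega), if_pos (by omega)]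
        omega
      · have : i = i₀ := Fin.ext h
        subst this
        rw [if_pos (by omega), if_pos (by omega)]
        omega
      · rw [if_neg (by omega), if_neg (by omega)]
    simp [hB, hAB, CharTwo.add_self_eq_zero]

lemma sum_edgeProd {N k : ℕ} (hN : 0 < N) (hkd : k ≤ d)
    (h0 : ∀ (i : Fin d) p, p i = 0 → lam i p = 0) (h1 : ∀ (i : Fin d) p, p i = N → lam i p = 1) :
    ∑ x ∈ faceBox d N k, edgeProd lam k x = 1 := by
  induction k with
  | zero =>
    have : faceBox d N 0 = {fun _ => (d + 1) * N} := by
      ext x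
      simp [mem_faceBox, funext_iff]
    simp [this, edgeProd]
  | succ k ih => rw [sum_edgeProd_succ lam hN hkd h0 h1, ih (by omega)]

/-- Cubical version of Sperner's lemma: if the `i`-th labelling of the grid `{0, …, N}ᵈ` is `0` on
the lower and `1` on the upper `i`-th face, then on some unit cube no labelling is constant. -/
theorem exists_cube_nonconstant {d N : ℕ} (hN : 0 < N) (lam : Fin d → (Fin d → ℕ) → ZMod 2)
    (h0 : ∀ i p, p i = 0 → lam i p = 0) (h1 : ∀ i p, p i = N → lam i p = 1) :
    ∃ v : Fin d → ℕ, (∀ i, v i < N) ∧ ∀ i, ∃ p q : Fin d → ℕ,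
      (∀ j, v j ≤ p j ∧ p j ≤ v j + 1) ∧ (∀ j, v j ≤ q j ∧ q j ≤ v j + 1) ∧
      lam i p = 0 ∧ lam i q = 1 := by
  let mu : ℕ → (Fin d → ℕ) → ZMod 2 := fun i p => if h : i < d then lam ⟨i, h⟩ p else 0
  have hmu : ∀ (i : Fin d) p, mu i p = lam i p := fun i p => by simp [mu]
  have hsum := sum_edgeProd mu hN le_rfl (fun i p hp => (hmu i p).trans (h0 i p hp))
    (fun i p hp => (hmu i p).trans (h1 i p hp))
  obtain ⟨x, hx, hne⟩ := Finset.exists_ne_zero_of_sum_ne_zero (hsum.trans_ne one_ne_zero)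
  have hvert : ∀ m < d + 1, ∀ j, vertex x 0 j ≤ vertex x m j ∧ vertex x m j ≤ vertex x 0 j + 1 := by
    intro m hm j
    refine ⟨Nat.div_le_div_right (by omega), ?_⟩
    simp only [vertex]
    rw [← Nat.add_div_right _ (by omega)]
    exact Nat.div_le_div_right (by omega)
  refine ⟨vertex x 0, fun i => ?_, fun i => ?_⟩
  · have := mem_faceBox.1 hx i
    rw [if_pos i.2] at this
    exact Nat.div_lt_of_lt_mul (by simpa using this)
  · have hi := Finset.prod_ne_zero_iff.1 hne i (Finset.mem_range.2 i.2)
    rw [hmu, hmu] at hi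
    have h01 : ∀ a b : ZMod 2, a + b ≠ 0 → (a = 0 ∧ b = 1) ∨ (b = 0 ∧ a = 1) := by decide
    rcases h01 _ _ hi with h | h
    · exact ⟨_, _, hvert _ (by omega), hvert _ (by omega), h.1, h.2⟩
    · exact ⟨_, _, hvert _ (by omega), hvert _ (by omega), h.1, h.2⟩

end KuhnGrid

open Filter Topology in
/-- **Brouwer's fixed point theorem** for the unit cube. -/
theorem exists_fixedPoint_of_mapsTo_cube {d : ℕ} (f : (Fin d → ℝ) → Fin d → ℝ)
    (hf : ContinuousOn f (Icc 0 1)) (hmaps : MapsTo f (Icc 0 1) (Icc 0 1)) :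
    ∃ x ∈ Icc (0 : Fin d → ℝ) 1, f x = x := by
  have hgrid : ∀ n : ℕ, ∃ v : Fin d → ℝ, v ∈ Icc 0 1 ∧ ∀ i, ∃ p q : Fin d → ℝ,
      p ∈ Icc 0 1 ∧ q ∈ Icc 0 1 ∧ dist p v ≤ 1 / ((n : ℝ) + 1) ∧ dist q v ≤ 1 / ((n : ℝ) + 1) ∧
      p i ≤ f p i ∧ f q i ≤ q i := by
    intro n
    have hn : (0 : ℝ) < (n : ℝ) + 1 := by positivity
    let s : (Fin d → ℕ) → Fin d → ℝ := fun p i => (p i : ℝ) / (n + 1)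
    have hs : ∀ p : Fin d → ℕ, (∀ i, p i ≤ n + 1) → s p ∈ Icc (0 : Fin d → ℝ) 1 := by
      intro p hp
      refine ⟨fun i => by simp only [s, Pi.zero_apply]; positivity, fun i => ?_⟩
      simp only [s, Pi.one_apply]
      rw [div_le_one hn]
      exact_mod_cast hp i
    let lam : Fin d → (Fin d → ℕ) → ZMod 2 := fun i p =>
      if p i = 0 then 0 else if p i = n + 1 then 1 else if f (s p) i ≤ s p i then 1 else 0
    obtain ⟨v, hv, hcube⟩ := KuhnGrid.exists_cube_nonconstant (N := n + 1) n.succ_pos lam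
      (fun i p hp => by simp [lam, hp]) (fun i p hp => by simp [lam, hp])
    have hdist : ∀ p : Fin d → ℕ, (∀ j, v j ≤ p j ∧ p j ≤ v j + 1) →
        dist (s p) (s v) ≤ 1 / ((n : ℝ) + 1) := by
      intro p hp
      rw [dist_pi_le_iff (by positivity)]
      intro j
      simp only [s, Real.dist_eq]
      rw [← sub_div, abs_div, abs_of_pos hn]
      have h1 : (v j : ℝ) ≤ p j := by exact_mod_cast (hp j).1
      have h2 : (p j : ℝ) ≤ v j + 1 := by exact_mod_cast (hp j).2
      gcongr
      rw [abs_le]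
      constructor <;> linarith
    refine ⟨s v, hs v fun i => (hv i).le, fun i => ?_⟩
    obtain ⟨p, q, hp, hq, hp0, hq1⟩ := hcube i
    have hpI := hs p fun j => by have := hp j; have := hv j; omega
    have hqI := hs q fun j => by have := hq j; have := hv j; omega
    refine ⟨s p, s q, hpI, hqI, hdist p hp, hdist q hq, ?_, ?_⟩
    · by_cases h : p i = 0
      · have := (hmaps hpI).1 i
        simpa [s, h] using this
      · simp only [lam, if_neg h] at hp0
        split_ifs at hp0 with h2 h3
        · simp at hp0
        · simp at hp0
        · exact (not_le.1 h3).le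
    · by_cases h : q i = n + 1
      · have := (hmaps hqI).2 i
        have h' : s q i = 1 := by simp [s, h, hn.ne']
        rwa [h']
      · simp only [lam, if_neg h] at hq1
        split_ifs at hq1 with h2 h3
        · simp at hq1
        · exact h3
        · simp at hq1
  choose v hv p q hp hq hpv hqv hpf hqf using hgrid
  obtain ⟨x, hx, φ, hφ, hlim⟩ := (isCompact_Icc (a := (0 : Fin d → ℝ)) (b := 1)).tendsto_subseq hv
  refine ⟨x, hx, funext fun i => ?_⟩
  have key : ∀ r : ℕ → Fin d → ℝ, (∀ n, r n ∈ Icc 0 1) →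
      (∀ n, dist (r n) (v n) ≤ 1 / ((n : ℝ) + 1)) →
      Tendsto (fun n => r (φ n) i) atTop (𝓝 (x i)) ∧
      Tendsto (fun n => f (r (φ n)) i) atTop (𝓝 (f x i)) := by
    intro r hr hrv
    have h1 : Tendsto (fun n => dist (v (φ n)) (r (φ n))) atTop (𝓝 0) :=
      (squeeze_zero (fun _ => dist_nonneg) (fun n => (dist_comm _ _).trans_le (hrv n))
        tendsto_one_div_add_atTop_nhds_zero_nat).comp hφ.tendsto_atTop
    have h2 : Tendsto (fun n => r (φ n)) atTop (𝓝 x) := (tendsto_iff_of_dist h1).1 hlim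
    have h3 : Tendsto (fun n => f (r (φ n))) atTop (𝓝 (f x)) :=
      (hf x hx).tendsto.comp (tendsto_nhdsWithin_iff.2 ⟨h2, .of_forall fun n => hr _⟩)
    exact ⟨(tendsto_pi_nhds.1 h2) i, (tendsto_pi_nhds.1 h3) i⟩
  obtain ⟨hp1, hp2⟩ := key (fun n => p n i) (fun n => hp n i) (fun n => hpv n i)
  obtain ⟨hq1, hq2⟩ := key (fun n => q n i) (fun n => hq n i) (fun n => hqv n i)
  exact le_antisymm (le_of_tendsto_of_tendsto' hq2 hq1 fun n => hqf _ i)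
    (le_of_tendsto_of_tendsto' hp1 hp2 fun n => hpf _ i)

lemma exists_continuous_stdSimplex_extension {X ι : Type*} [PseudoMetricSpace X]
    [Fintype ι] [Nonempty ι] {S : Set X}
    (hS : IsClosed S) (hSne : S.Nonempty) {b : X → ι → ℝ} (hb : ContinuousOn b S)
    (hb0 : ∀ x ∈ S, ∀ i, 0 ≤ b x i) (hbpos : ∀ x ∈ S, 0 < ∑ i, b x i) :
    ∃ β : X → ι → ℝ, Continuous β ∧ (∀ x, β x ∈ stdSimplex ℝ ι) ∧
      ∀ x ∈ S, β x = (∑ i, b x i)⁻¹ • b x := by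
  obtain ⟨g, hg⟩ := ContinuousMap.exists_restrict_eq hS ⟨S.domRestrict b, hb.domRestrict⟩
  have hgS : ∀ x ∈ S, g x = b x := fun x hx => congrFun (congrArg DFunLike.coe hg) ⟨x, hx⟩
  let γ : X → ι → ℝ := fun x i => |g x i| + Metric.infDist x S
  have hγc : Continuous γ := by
    have := Metric.continuous_infDist_pt S
    fun_prop
  have hγ0 : ∀ x i, 0 ≤ γ x i := fun x i => add_nonneg (abs_nonneg _) Metric.infDist_nonneg
  have hγS : ∀ x ∈ S, γ x = b x := by
    intro x hx
    funext i
    simp only [γ, hgS x hx, abs_of_nonneg (hb0 x hx i), Metric.infDist_zero_of_mem hx, add_zero]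
  have hγpos : ∀ x, 0 < ∑ i, γ x i := by
    intro x
    by_cases hx : x ∈ S
    · rw [hγS x hx]
      exact hbpos x hx
    · exact Finset.sum_pos (fun i _ => add_pos_of_nonneg_of_pos (abs_nonneg _)
        ((hS.notMem_iff_infDist_pos hSne).1 hx)) Finset.univ_nonempty
  refine ⟨fun x => (∑ i, γ x i)⁻¹ • γ x, ?_, fun x => ⟨fun i => ?_, ?_⟩, fun x hx => ?_⟩
  · refine Continuous.smul (Continuous.inv₀ (by fun_prop) fun x => (hγpos x).ne') hγc
  · exact mul_nonneg (inv_nonneg.2 (hγpos x).le) (hγ0 x i)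
  · simp only [Pi.smul_apply, smul_eq_mul, ← Finset.mul_sum]
    exact inv_mul_cancel₀ (hγpos x).ne'
  · simp only [hγS x hx]

section PointedCone

variable {X : Type*} [NormedAddCommGroup X] [NormedSpace ℝ X] {K : Set X}

lemma sum_smul_mem_of_cone {ι : Type*} (h0 : (0 : X) ∈ K) (hKadd : ∀ x ∈ K, ∀ y ∈ K, x + y ∈ K)
    (hKsmul : ∀ μ : ℝ, 0 ≤ μ → ∀ x ∈ K, μ • x ∈ K) {y : ι → X} (hy : ∀ i, y i ∈ K)
    (s : Finset ι) {a : ι → ℝ} (ha : ∀ i, 0 ≤ a i) : ∑ i ∈ s, a i • y i ∈ K :=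
  Finset.sum_induction _ (· ∈ K) (fun x z hx hz => hKadd x hx z hz) h0
    fun i _ => hKsmul _ (ha i) _ (hy i)

lemma exists_pos_mul_sum_le_norm_sum_smul {ι : Type*} [Fintype ι] [Nonempty ι]
    (h0 : (0 : X) ∈ K) (hKadd : ∀ x ∈ K, ∀ y ∈ K, x + y ∈ K)
    (hKsmul : ∀ μ : ℝ, 0 ≤ μ → ∀ x ∈ K, μ • x ∈ K)
    (hKpointed : ∀ x, x ∈ K → -x ∈ K → x = 0) {y : ι → X} (hy : ∀ i, y i ∈ K)
    (hy0 : ∀ i, y i ≠ 0) :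
    ∃ δ > 0, ∀ a ∈ stdSimplex ℝ ι, δ ≤ ‖∑ i, a i • y i‖ := by
  classical
  have hcont : Continuous fun a : ι → ℝ => ‖∑ i, a i • y i‖ := by fun_prop
  obtain ⟨a, ha, hmin⟩ := (isCompact_stdSimplex (𝕜 := ℝ) ι).exists_isMinOn
    ⟨_, single_mem_stdSimplex ℝ (Classical.arbitrary ι)⟩ hcont.continuousOn
  refine ⟨_, norm_pos_iff.2 fun hsum => ?_, fun b hb => hmin hb⟩
  obtain ⟨j, -, hj⟩ := Finset.exists_ne_zero_of_sum_ne_zero (ha.2.trans_ne one_ne_zero)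
  rw [← Finset.add_sum_erase _ _ (Finset.mem_univ j), add_eq_zero_iff_neg_eq] at hsum
  have := hKpointed (a j • y j) (hKsmul _ (ha.1 j) _ (hy j))
    (hsum ▸ sum_smul_mem_of_cone h0 hKadd hKsmul hy _ ha.1)
  exact (smul_ne_zero hj (hy0 j)) this

/-- The Birkhoff–Kellogg theorem in a pointed cone for maps into the conic hull of finitely many
points. -/
lemma exists_eq_smul_sum_of_cone {U : Set X} (hUopen : IsOpen U) (hUbdd : Bornology.IsBounded U)
    (hU0 : (0 : X) ∈ U) (hKclosed : IsClosed K) (hKadd : ∀ x ∈ K, ∀ y ∈ K, x + y ∈ K)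
    (hKsmul : ∀ μ : ℝ, 0 ≤ μ → ∀ x ∈ K, μ • x ∈ K) (hKpointed : ∀ x, x ∈ K → -x ∈ K → x = 0)
    (hSne : (K ∩ frontier U).Nonempty) {m : ℕ} {y : Fin m → X} (hy : ∀ i, y i ∈ K)
    (hy0 : ∀ i, y i ≠ 0) {b : X → Fin m → ℝ} (hb : ContinuousOn b (K ∩ frontier U))
    (hb0 : ∀ x ∈ K ∩ frontier U, ∀ i, 0 ≤ b x i)
    (hbpos : ∀ x ∈ K ∩ frontier U, 0 < ∑ i, b x i) :
    ∃ x ∈ K ∩ frontier U, ∃ c : ℝ, x = c • ∑ i, b x i • y i := by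
  obtain ⟨x₀, hx₀⟩ := hSne
  have h0 : (0 : X) ∈ K := by simpa using hKsmul 0 le_rfl x₀ hx₀.1
  have hne : Nonempty (Fin m) := by
    by_contra h
    rw [not_nonempty_iff] at h
    simpa using hbpos x₀ hx₀
  obtain ⟨β, hβc, hβ, hβS⟩ := exists_continuous_stdSimplex_extension
    (hKclosed.inter isClosed_frontier) ⟨x₀, hx₀⟩ hb hb0 hbpos
  obtain ⟨δ, hδ, hδle⟩ := exists_pos_mul_sum_le_norm_sum_smul h0 hKadd hKsmul hKpointed hy hy0
  obtain ⟨r, hr⟩ := hUbdd.exists_norm_le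
  have hr0 : 0 ≤ r := (norm_nonneg _).trans (hr 0 hU0)
  let G : X → X := fun x => ∑ i, β x i • y i
  have hGc : Continuous G := by fun_prop
  have hGδ : ∀ x, δ ≤ ‖G x‖ := fun x => hδle _ (hβ x)
  by_contra! hcon
  let C : Set X := (K ∩ closure U) ∩ {x | ‖G x‖ • x = ‖x‖ • G x}
  have hC : IsClosed C :=
    (hKclosed.inter isClosed_closure).inter (isClosed_eq (by fun_prop) (by fun_prop))
  have hdisj : Disjoint Uᶜ C := by
    rw [Set.disjoint_left]
    rintro x hxU ⟨⟨hxK, hxcl⟩, hx⟩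
    have hxS : x ∈ K ∩ frontier U := ⟨hxK, by rw [hUopen.frontier_eq]; exact ⟨hxcl, hxU⟩⟩
    refine hcon x hxS (‖G x‖⁻¹ * ‖x‖ * (∑ i, b x i)⁻¹) ?_
    have hG : G x = (∑ i, b x i)⁻¹ • ∑ i, b x i • y i := by
      simp only [G, hβS x hxS, Pi.smul_apply, smul_assoc, ← Finset.smul_sum]
    rw [mul_smul, ← hG, mul_smul, ← show ‖G x‖ • x = ‖x‖ • G x from hx,
      inv_smul_smul₀ (hδ.trans_le (hGδ x)).ne']
  obtain ⟨φ, hφ0, hφ1, hφ⟩ := exists_continuous_zero_one_of_isClosed hUopen.isClosed_compl hC hdisj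
  let R : ℝ := (r + 1) / δ
  have hR : 0 < R := by positivity
  let e : (Fin m → ℝ) → X := fun a => R • ∑ i, a i • y i
  obtain ⟨a, ha, hfix⟩ := exists_fixedPoint_of_mapsTo_cube (fun a => φ (e a) • β (e a))
    (Continuous.continuousOn (by fun_prop)) (by
      intro a _
      refine ⟨fun i => mul_nonneg (hφ _).1 ((hβ _).1 i), fun i => ?_⟩
      exact mul_le_one₀ (hφ _).2 ((hβ _).1 i) (mem_Icc_of_mem_stdSimplex (hβ _) i).2)
  set x := e a with hx
  have hxG : x = (R * φ x) • G x := by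
    have hsum : ∑ i, a i • y i = φ x • G x := by
      simp_rw [G, Finset.smul_sum, smul_smul]
      exact Finset.sum_congr rfl fun i _ => congrArg (· • y i) (congrFun hfix i).symm
    rw [mul_smul, ← hsum]
  have hxK : x ∈ K := hKsmul _ hR.le _ (sum_smul_mem_of_cone h0 hKadd hKsmul hy _ ha.1)
  by_cases hxU : x ∈ U
  · have hnorm : ‖x‖ = R * φ x * ‖G x‖ := by
      conv_lhs => rw [hxG, norm_smul, Real.norm_of_nonneg (mul_nonneg hR.le (hφ x).1)]
    have hxC : x ∈ C := by
      refine ⟨⟨hxK, subset_closure hxU⟩, ?_⟩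
      change ‖G x‖ • x = ‖x‖ • G x
      rw [hnorm, mul_comm, mul_smul, ← hxG]
    have h1 : φ x = 1 := hφ1 hxC
    rw [h1, mul_one] at hnorm
    have h2 : R * δ = r + 1 := div_mul_cancel₀ _ hδ.ne'
    have h3 := mul_le_mul_of_nonneg_left (hGδ x) hR.le
    have h4 := hr x hxU
    linarith
  · have h1 : φ x = 0 := hφ0 hxU
    rw [h1, mul_zero, zero_smul] at hxG
    exact hxU (hxG ▸ hU0)

lemma exists_eq_smul_dist_le_of_cone {U : Set X} (hUopen : IsOpen U)
    (hUbdd : Bornology.IsBounded U) (hU0 : (0 : X) ∈ U) (hKclosed : IsClosed K)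
    (hKadd : ∀ x ∈ K, ∀ y ∈ K, x + y ∈ K) (hKsmul : ∀ μ : ℝ, 0 ≤ μ → ∀ x ∈ K, μ • x ∈ K)
    (hKpointed : ∀ x, x ∈ K → -x ∈ K → x = 0) (hSne : (K ∩ frontier U).Nonempty) {T : X → X}
    (hTmaps : ∀ x ∈ K ∩ frontier U, T x ∈ K) (hTne : ∀ x ∈ K ∩ frontier U, T x ≠ 0)
    (hTcont : ContinuousOn T (K ∩ frontier U)) (hTtb : TotallyBounded (T '' (K ∩ frontier U)))
    {ε : ℝ} (hε : 0 < ε) :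
    ∃ x ∈ K ∩ frontier U, ∃ c : ℝ, ∃ w, x = c • w ∧ dist w (T x) ≤ ε := by
  obtain ⟨t, htS, htfin, hcov⟩ := Metric.finite_approx_of_totallyBounded hTtb ε hε
  obtain ⟨m, y, hy⟩ := htfin.fin_param
  have hyt : ∀ i, y i ∈ t := fun i => hy.2 ▸ mem_range_self i
  let b : X → Fin m → ℝ := fun x i => max 0 (ε - dist (y i) (T x))
  have hb0 : ∀ x i, 0 ≤ b x i := fun x i => le_max_left _ _
  have hbpos : ∀ x ∈ K ∩ frontier U, 0 < ∑ i, b x i := by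
    intro x hx
    obtain ⟨z, hz, hxz⟩ := mem_iUnion₂.1 (hcov (mem_image_of_mem T hx))
    rw [← hy.2] at hz
    obtain ⟨i, rfl⟩ := hz
    refine Finset.sum_pos' (fun i _ => hb0 x i) ⟨i, Finset.mem_univ i, lt_max_of_lt_right ?_⟩
    rw [dist_comm]
    exact sub_pos.2 hxz
  have hbc : ContinuousOn b (K ∩ frontier U) := by
    refine continuousOn_pi.2 fun i => ?_
    exact ContinuousOn.sup continuousOn_const
      (continuousOn_const.sub
      (continuous_dist.comp_continuousOn (continuousOn_const.prodMk hTcont)))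
  obtain ⟨x, hx, c, hxc⟩ := exists_eq_smul_sum_of_cone hUopen hUbdd hU0 hKclosed hKadd hKsmul
    hKpointed hSne (y := y)
    (fun i => by obtain ⟨z, hz, hzy⟩ := htS (hyt i); exact hzy ▸ hTmaps z hz)
    (fun i => by obtain ⟨z, hz, hzy⟩ := htS (hyt i); exact hzy ▸ hTne z hz) hbc
    (fun x _ => hb0 x) hbpos
  have hpos := hbpos x hx
  refine ⟨x, hx, c * ∑ i, b x i, (∑ i, b x i)⁻¹ • ∑ i, b x i • y i, ?_, ?_⟩
  · rw [mul_smul, smul_inv_smul₀ hpos.ne']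
    exact hxc
  · have hsub : (∑ i, b x i)⁻¹ • ∑ i, b x i • y i - T x =
        (∑ i, b x i)⁻¹ • ∑ i, b x i • (y i - T x) := by
      simp only [smul_sub, Finset.sum_sub_distrib, ← Finset.sum_smul]
      rw [inv_smul_smul₀ hpos.ne']
    rw [dist_eq_norm, hsub, norm_smul, norm_inv, Real.norm_of_nonneg hpos.le,
      inv_mul_le_iff₀ hpos, Finset.sum_mul]
    refine norm_sum_le_of_le _ fun i _ => ?_
    rw [norm_smul, Real.norm_of_nonneg (hb0 x i), ← dist_eq_norm]
    rcases le_or_gt (dist (y i) (T x)) ε with h | h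
    · exact mul_le_mul_of_nonneg_left h (hb0 x i)
    · simp [b, max_eq_left (sub_nonpos.2 h.le)]

end PointedCone

/-- Birkhoff–Kellogg type theorem of Krasnosel'skiĭ and Ladyženskiĭ: if `X` is a real
Banach space, `U ⊆ X` is open and bounded with `0 ∈ U`, `K ⊆ X` is a cone, and
`T : K ∩ cl(U) → K` is compact (continuous with relatively compact image) with
`inf_{x ∈ K ∩ ∂U} ‖Tx‖ > 0`, then there exist `λ₀ ∈ (0,∞)` and `x₀ ∈ K ∩ ∂U`
with `x₀ = λ₀ T x₀`. -/
theorem birkhoff_kellogg_krasnoselskii_ladyzhenskii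
    {X : Type*} [NormedAddCommGroup X] [NormedSpace ℝ X] [CompleteSpace X]
    (U : Set X) (hUopen : IsOpen U) (hUbdd : Bornology.IsBounded U) (hU0 : (0:X) ∈ U)
    (K : Set X) (hKclosed : IsClosed K)
    (hKadd : ∀ x ∈ K, ∀ y ∈ K, x + y ∈ K)
    (hKsmul : ∀ μ : ℝ, 0 ≤ μ → ∀ x ∈ K, μ • x ∈ K)
    (hKpointed : ∀ x, x ∈ K → -x ∈ K → x = 0)
    (T : X → X)
    (hTmaps : ∀ x ∈ K ∩ closure U, T x ∈ K)
    (hTcont : ContinuousOn T (K ∩ closure U))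
    (hTcompact : IsCompact (closure (T '' (K ∩ closure U))))
    (hinf : 0 < sInf ((fun x => ‖T x‖) '' (K ∩ frontier U))) :
    ∃ lam : ℝ, 0 < lam ∧ ∃ x ∈ K ∩ frontier U, x = lam • T x := by
  have hSsub : K ∩ frontier U ⊆ K ∩ closure U := inter_subset_inter_right K frontier_subset_closure
  have hSne : (K ∩ frontier U).Nonempty := by
    by_contra h
    rw [not_nonempty_iff_eq_empty] at h
    simp [h] at hinf
  have hlow : ∀ x ∈ K ∩ frontier U, sInf ((fun x => ‖T x‖) '' (K ∩ frontier U)) ≤ ‖T x‖ :=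
    fun x hx => csInf_le ⟨0, by rintro _ ⟨z, -, rfl⟩; exact norm_nonneg _⟩ (mem_image_of_mem _ hx)
  have hTne : ∀ x ∈ K ∩ frontier U, T x ≠ 0 := fun x hx =>
    norm_pos_iff.1 (hinf.trans_le (hlow x hx))
  have happrox : ∀ n : ℕ, ∃ x ∈ K ∩ frontier U, ∃ c : ℝ, ∃ w,
      x = c • w ∧ dist w (T x) ≤ 1 / ((n : ℝ) + 1) := fun n =>
    exists_eq_smul_dist_le_of_cone hUopen hUbdd hU0 hKclosed hKadd hKsmul hKpointed hSne
      (fun x hx => hTmaps x (hSsub hx)) hTne (hTcont.mono hSsub)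
      (hTcompact.totallyBounded.subset ((image_mono hSsub).trans subset_closure))
      Nat.one_div_pos_of_nat
  choose x hxS c w hxw hwT using happrox
  obtain ⟨r, hr⟩ := hUbdd.closure.exists_norm_le
  have hcr : ∀ n, (T (x n), c n * ‖w n‖) ∈ closure (T '' (K ∩ closure U)) ×ˢ Icc (-r) r := by
    intro n
    refine ⟨subset_closure (mem_image_of_mem T (hSsub (hxS n))), abs_le.1 ?_⟩
    rw [abs_mul, abs_norm, ← Real.norm_eq_abs, ← norm_smul, ← hxw n]
    exact hr _ (hSsub (hxS n)).2
  obtain ⟨⟨z, ρ⟩, -, φ, hφ, hlim⟩ := (hTcompact.prod isCompact_Icc).tendsto_subseq hcr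
  obtain ⟨hTz, hρ⟩ := Prod.tendsto_iff _ _ |>.1 hlim
  have hwz : Filter.Tendsto (fun n => w (φ n)) Filter.atTop (nhds z) := by
    refine (tendsto_iff_of_dist ?_).2 hTz
    exact (squeeze_zero (fun _ => dist_nonneg) hwT
      tendsto_one_div_add_atTop_nhds_zero_nat).comp hφ.tendsto_atTop
  have hz : z ≠ 0 := norm_pos_iff.1 (hinf.trans_le
    (ge_of_tendsto' hTz.norm fun n => hlow _ (hxS (φ n))))
  have hxlim : Filter.Tendsto (fun n => x (φ n)) Filter.atTop (nhds ((ρ * ‖z‖⁻¹) • z)) := by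
    refine ((hρ.mul (hwz.norm.inv₀ (norm_ne_zero_iff.2 hz))).smul hwz).congr' ?_
    filter_upwards [hwz.eventually_ne hz] with n hn
    simp only [Function.comp_apply]
    rw [mul_inv_cancel_right₀ (norm_ne_zero_iff.2 hn), ← hxw]
  set p := (ρ * ‖z‖⁻¹) • z with hp
  have hpS : p ∈ K ∩ frontier U := (hKclosed.inter isClosed_frontier).mem_of_tendsto hxlim
    (Filter.Eventually.of_forall fun n => hxS _)
  have hTp : T p = z := tendsto_nhds_unique ((hTcont p (hSsub hpS)).tendsto.comp
    (tendsto_nhdsWithin_iff.2 ⟨hxlim, Filter.Eventually.of_forall fun n => hSsub (hxS _)⟩)) hTz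
  have hp0 : p ≠ 0 := by
    intro h
    have := hpS.2
    rw [h, hUopen.frontier_eq] at this
    exact this.2 hU0
  refine ⟨ρ * ‖z‖⁻¹, ?_, p, hpS, by rw [hTp]⟩
  by_contra! hneg
  have hTK := hTmaps p (hSsub hpS)
  rw [hTp] at hTK
  refine hp0 (hKpointed p hpS.1 ?_)
  rw [hp, ← neg_smul]
  exact hKsmul _ (neg_nonneg.2 hneg) z hTK
end

section
/- Let ρ > 0, let Π_ρ = [0,1] × [0,ρ]³ × [−ρ,0], and suppose f : Π_ρ → ℝ is continuous with f(t,u,v,w,z) ≥ 0 on Π_ρ, and H is a continuous bounded functional on K̄_ρ = {u ∈ K : ‖u‖₃ ≤ ρ} with H[u] ≥ 0 for all u ∈ K̄_ρ. Define Tu(t) = γ(t)H[u] + ∫₀¹ k(t,s) f(s, u(s), u′(s), u″(s), u‴(s)) ds. Then T maps K̄_ρ into K and T : K̄_ρ → K is a compact operator (continuous with relatively compact image). -/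
open Set MeasureTheory Filter Topology

/-- `γ(t) = (1/6)(3t² − t³)`. -/
noncomputable def gam (t : ℝ) : ℝ := (3 * t ^ 2 - t ^ 3) / 6

/-- The sup norm over `[0,1]`: `‖w‖_∞ = sup_{t∈[0,1]} |w(t)|`. -/
noncomputable def supN (w : ℝ → ℝ) : ℝ := ⨆ t : Icc (0:ℝ) 1, |w ↑t|

/-- The `C³[0,1]` norm `‖u‖₃ = max_{j=0,…,3} ‖u⁽ʲ⁾‖_∞`. -/
noncomputable def norm3 (u : ℝ → ℝ) : ℝ :=
  max (max (supN u) (supN (deriv u))) (max (supN (deriv^[2] u)) (supN (deriv^[3] u)))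

/-- The cone `K = {u ∈ C³[0,1] : u, u′, u″, −u‴ ≥ 0 on [0,1]}`, where elements of
`C³[0,1]` are represented by three times continuously differentiable functions on `ℝ`. -/
def coneK : Set (ℝ → ℝ) :=
  {u | ContDiff ℝ 3 u ∧ ∀ t ∈ Icc (0:ℝ) 1,
    0 ≤ u t ∧ 0 ≤ deriv u t ∧ 0 ≤ deriv^[2] u t ∧ 0 ≤ -(deriv^[3] u t)}

/-- `K̄_ρ = {u ∈ K : ‖u‖₃ ≤ ρ}`. -/
def Kbar (ρ : ℝ) : Set (ℝ → ℝ) := {u ∈ coneK | norm3 u ≤ ρ}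

/-- `∂K_ρ = {u ∈ K : ‖u‖₃ = ρ}`. -/
def Kbdry (ρ : ℝ) : Set (ℝ → ℝ) := {u ∈ coneK | norm3 u = ρ}

/-- `Π_ρ = [0,1] × [0,ρ]³ × [−ρ,0]`. -/
def PiSet (ρ : ℝ) : Set (ℝ × ℝ × ℝ × ℝ × ℝ) :=
  {p | p.1 ∈ Icc (0:ℝ) 1 ∧ p.2.1 ∈ Icc 0 ρ ∧ p.2.2.1 ∈ Icc 0 ρ ∧
       p.2.2.2.1 ∈ Icc 0 ρ ∧ p.2.2.2.2 ∈ Icc (-ρ) 0}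

/-- The operator `Tu(t) = γ(t)H[u] + ∫₀¹ k(t,s) f(s, u(s), u′(s), u″(s), u‴(s)) ds`. -/
noncomputable def Toper (f : ℝ × ℝ × ℝ × ℝ × ℝ → ℝ) (H : (ℝ → ℝ) → ℝ) (u : ℝ → ℝ) :
    ℝ → ℝ :=
  fun t => gam t * H u +
    ∫ s in (0:ℝ)..1, kern t s * f (s, u s, deriv u s, deriv^[2] u s, deriv^[3] u s)

/-- Continuity of a functional `H` on a subset `S` of `C³[0,1]` with respect to `‖·‖₃`. -/
def ContOn3 (H : (ℝ → ℝ) → ℝ) (S : Set (ℝ → ℝ)) : Prop :=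
  ∀ u ∈ S, ∀ ε > (0:ℝ), ∃ δ > (0:ℝ), ∀ v ∈ S, norm3 (u - v) < δ → |H u - H v| < ε

/-- Boundedness of a functional `H` on a subset `S` of `C³[0,1]`. -/
def BddOn3 (H : (ℝ → ℝ) → ℝ) (S : Set (ℝ → ℝ)) : Prop :=
  ∃ M : ℝ, ∀ u ∈ S, |H u| ≤ M

/-- `w` is three times continuously differentiable with successive derivatives `w₁, w₂, w₃`. -/
def IsJet3 (w w₁ w₂ w₃ : ℝ → ℝ) : Prop :=
  (∀ t, HasDerivAt w (w₁ t) t) ∧ (∀ t, HasDerivAt w₁ (w₂ t) t) ∧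
    (∀ t, HasDerivAt w₂ (w₃ t) t) ∧ Continuous w₃

namespace IsJet3

variable {v v₁ v₂ v₃ w w₁ w₂ w₃ : ℝ → ℝ}

lemma deriv_eq (h : IsJet3 w w₁ w₂ w₃) : deriv w = w₁ := funext fun t => (h.1 t).deriv

lemma deriv2_eq (h : IsJet3 w w₁ w₂ w₃) : deriv^[2] w = w₂ := by
  have : deriv w₁ = w₂ := funext fun t => (h.2.1 t).deriv
  simp [Function.iterate_succ_apply, h.deriv_eq, this]

lemma deriv3_eq (h : IsJet3 w w₁ w₂ w₃) : deriv^[3] w = w₃ := by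
  rw [Function.iterate_succ_apply', h.deriv2_eq]
  exact funext fun t => (h.2.2.1 t).deriv

lemma contDiff (h : IsJet3 w w₁ w₂ w₃) : ContDiff ℝ 3 w := by
  have step : ∀ (n : ℕ) {a b : ℝ → ℝ}, (∀ t, HasDerivAt a (b t) t) → ContDiff ℝ n b →
      ContDiff ℝ ((n + 1 : ℕ) : WithTop ℕ∞) a := by
    intro n a b hab hb
    have : deriv a = b := funext fun t => (hab t).deriv
    push_cast
    rw [contDiff_succ_iff_deriv, this]
    exact ⟨fun t => (hab t).differentiableAt, by simp, hb⟩
  exact_mod_cast step 2 h.1 (step 1 h.2.1 (step 0 h.2.2.1 (contDiff_zero.2 h.2.2.2)))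

lemma sub (hv : IsJet3 v v₁ v₂ v₃) (hw : IsJet3 w w₁ w₂ w₃) :
    IsJet3 (v - w) (v₁ - w₁) (v₂ - w₂) (v₃ - w₃) :=
  ⟨fun t => (hv.1 t).sub (hw.1 t), fun t => (hv.2.1 t).sub (hw.2.1 t),
    fun t => (hv.2.2.1 t).sub (hw.2.2.1 t), hv.2.2.2.sub hw.2.2.2⟩

end IsJet3

lemma isJet3_of_contDiff {w : ℝ → ℝ} (h : ContDiff ℝ 3 w) :
    IsJet3 w (deriv w) (deriv^[2] w) (deriv^[3] w) := by
  have h1 : ContDiff ℝ (2 : ℕ) (deriv^[1] w) := ContDiff.iterate_deriv' 2 1 (by exact_mod_cast h)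
  have h2 : ContDiff ℝ (1 : ℕ) (deriv^[2] w) := ContDiff.iterate_deriv' 1 2 (by exact_mod_cast h)
  have h3 : ContDiff ℝ (0 : ℕ) (deriv^[3] w) := ContDiff.iterate_deriv' 0 3 (by exact_mod_cast h)
  refine ⟨fun t => (h.differentiable (by norm_num) t).hasDerivAt, fun t => ?_, fun t => ?_,
    h3.continuous⟩
  · exact (h1.differentiable (by norm_num) t).hasDerivAt
  · rw [Function.iterate_succ_apply' deriv 2]
    exact (h2.differentiable (by norm_num) t).hasDerivAt

lemma abs_le_supN {w : ℝ → ℝ} (hw : Continuous w) {t : ℝ} (ht : t ∈ Icc (0 : ℝ) 1) :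
    |w t| ≤ supN w := by
  have hb : BddAbove (range fun t : Icc (0 : ℝ) 1 => |w t|) :=
    (isCompact_range (by fun_prop)).bddAbove
  exact le_ciSup hb ⟨t, ht⟩

lemma supN_le {w : ℝ → ℝ} {C : ℝ} (h : ∀ t ∈ Icc (0 : ℝ) 1, |w t| ≤ C) : supN w ≤ C :=
  haveI : Nonempty (Icc (0 : ℝ) 1) := ⟨⟨0, by simp⟩⟩
  ciSup_le fun t => h t t.2

lemma supN_nonneg (w : ℝ → ℝ) : 0 ≤ supN w := Real.iSup_nonneg fun _ => abs_nonneg _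

lemma norm3_nonneg (w : ℝ → ℝ) : 0 ≤ norm3 w :=
  (supN_nonneg w).trans ((le_max_left _ _).trans (le_max_left _ _))

lemma IsJet3.abs_le_norm3 {w w₁ w₂ w₃ : ℝ → ℝ} (h : IsJet3 w w₁ w₂ w₃) {t : ℝ}
    (ht : t ∈ Icc (0 : ℝ) 1) :
    |w t| ≤ norm3 w ∧ |w₁ t| ≤ norm3 w ∧ |w₂ t| ≤ norm3 w ∧ |w₃ t| ≤ norm3 w := by
  have c0 : Continuous w := continuous_iff_continuousAt.2 fun t => (h.1 t).continuousAt
  have c1 : Continuous w₁ := continuous_iff_continuousAt.2 fun t => (h.2.1 t).continuousAt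
  have c2 : Continuous w₂ := continuous_iff_continuousAt.2 fun t => (h.2.2.1 t).continuousAt
  rw [norm3, h.deriv_eq, h.deriv2_eq, h.deriv3_eq]
  have b0 := abs_le_supN c0 ht
  have b1 := abs_le_supN c1 ht
  have b2 := abs_le_supN c2 ht
  have b3 := abs_le_supN h.2.2.2 ht
  simp only [le_max_iff]
  tauto

lemma abs_le_of_hasDerivAt {w w' : ℝ → ℝ} (hw : ∀ t, HasDerivAt w (w' t) t) {C : ℝ}
    (hC : ∀ t ∈ Icc (0 : ℝ) 1, |w' t| ≤ C) {a : ℝ} (ha : a ∈ Icc (0 : ℝ) 1) (hwa : w a = 0) :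
    ∀ t ∈ Icc (0 : ℝ) 1, |w t| ≤ C := by
  intro t ht
  have h := (convex_Icc (0 : ℝ) 1).norm_image_sub_le_of_norm_hasDerivWithin_le
    (fun x _ => (hw x).hasDerivWithinAt) hC ha ht
  rw [hwa, sub_zero, Real.norm_eq_abs, Real.norm_eq_abs] at h
  have h0 : 0 ≤ C := (abs_nonneg _).trans (hC a ha)
  have h1 : |t - a| ≤ 1 := by
    rw [abs_le]; constructor <;> linarith [ha.1, ha.2, ht.1, ht.2]
  exact h.trans (mul_le_of_le_one_right h0 h1)

/-- The boundary conditions `w(0) = w'(0) = w''(1) = 0` of the Green's function let the third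
derivative control the whole `C³` norm. -/
lemma IsJet3.norm3_le {w w₁ w₂ w₃ : ℝ → ℝ} (h : IsJet3 w w₁ w₂ w₃) (h0 : w 0 = 0)
    (h1 : w₁ 0 = 0) (h2 : w₂ 1 = 0) {C : ℝ} (hC : ∀ t ∈ Icc (0 : ℝ) 1, |w₃ t| ≤ C) :
    norm3 w ≤ C := by
  have b2 := abs_le_of_hasDerivAt h.2.2.1 hC (by simp) h2
  have b1 := abs_le_of_hasDerivAt h.2.1 b2 (by simp) h1
  have b0 := abs_le_of_hasDerivAt h.1 b1 (by simp) h0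
  rw [norm3, h.deriv_eq, h.deriv2_eq, h.deriv3_eq]
  exact max_le (max_le (supN_le b0) (supN_le b1)) (max_le (supN_le b2) (supN_le hC))

lemma monotoneOn_of_hasDerivAt {w w' : ℝ → ℝ} (hw : ∀ t, HasDerivAt w (w' t) t)
    (h : ∀ t ∈ Icc (0 : ℝ) 1, 0 ≤ w' t) : MonotoneOn w (Icc 0 1) :=
  monotoneOn_of_deriv_nonneg (convex_Icc 0 1) (fun t _ => (hw t).continuousAt.continuousWithinAt)
    (fun t _ => (hw t).differentiableAt.differentiableWithinAt)
    fun t ht => by rw [(hw t).deriv]; exact h t (interior_subset ht)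

lemma IsJet3.mem_coneK {w w₁ w₂ w₃ : ℝ → ℝ} (h : IsJet3 w w₁ w₂ w₃) (h0 : w 0 = 0)
    (h1 : w₁ 0 = 0) (h2 : w₂ 1 = 0) (hneg : ∀ t ∈ Icc (0 : ℝ) 1, w₃ t ≤ 0) : w ∈ coneK := by
  have b2 : ∀ t ∈ Icc (0 : ℝ) 1, 0 ≤ w₂ t := by
    intro t ht
    have := monotoneOn_of_hasDerivAt (fun t => (h.2.2.1 t).neg)
      (fun t ht => neg_nonneg.2 (hneg t ht)) ht (right_mem_Icc.2 zero_le_one) ht.2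
    simpa [h2] using this
  have b1 : ∀ t ∈ Icc (0 : ℝ) 1, 0 ≤ w₁ t := fun t ht =>
    h1 ▸ monotoneOn_of_hasDerivAt h.2.1 b2 (left_mem_Icc.2 zero_le_one) ht ht.1
  have b0 : ∀ t ∈ Icc (0 : ℝ) 1, 0 ≤ w t := fun t ht =>
    h0 ▸ monotoneOn_of_hasDerivAt h.1 b1 (left_mem_Icc.2 zero_le_one) ht ht.1
  refine ⟨h.contDiff, fun t ht => ?_⟩
  rw [h.deriv_eq, h.deriv2_eq, h.deriv3_eq]
  exact ⟨b0 t ht, b1 t ht, b2 t ht, neg_nonneg.2 (hneg t ht)⟩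

/-- Every continuous function is the third derivative of a `C³` function satisfying the boundary
conditions of the Green's function. -/
lemma exists_isJet3_of_continuous {h : ℝ → ℝ} (hh : Continuous h) :
    ∃ w w₁ w₂ : ℝ → ℝ, IsJet3 w w₁ w₂ h ∧ w 0 = 0 ∧ w₁ 0 = 0 ∧ w₂ 1 = 0 := by
  have key : ∀ {g : ℝ → ℝ}, Continuous g → ∀ a : ℝ, ∃ G : ℝ → ℝ,
      (∀ t, HasDerivAt G (g t) t) ∧ Continuous G ∧ G a = 0 := fun {g} hg a =>
    have hd := fun t => (hg.integral_hasStrictDerivAt a t).hasDerivAt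
    ⟨fun t => ∫ x in a..t, g x, hd,
      continuous_iff_continuousAt.2 fun t => (hd t).continuousAt, by simp⟩
  obtain ⟨w₂, d2, c2, e2⟩ := key hh 1
  obtain ⟨w₁, d1, c1, e1⟩ := key c2 0
  obtain ⟨w, d0, -, e0⟩ := key c1 0
  exact ⟨w, w₁, w₂, ⟨d0, d1, d2, hh⟩, e0, e1, e2⟩

section Kernel

variable {g : ℝ → ℝ}

/-- The moments `∫₀¹ (s - t)₊ʲ g(s) ds`. -/
noncomputable def truncMoment (g : ℝ → ℝ) (j : ℕ) (t : ℝ) : ℝ :=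
  ∫ s in (0 : ℝ)..1, max (s - t) 0 ^ j * g s

/-- The tail integral `∫₀¹ 1_{t < s} g(s) ds`. -/
noncomputable def tailIntegral (g : ℝ → ℝ) (t : ℝ) : ℝ :=
  ∫ s in (0 : ℝ)..1, if t < s then g s else 0

lemma intervalIntegrable_mul_of_continuous (hg : IntervalIntegrable g volume 0 1) {c : ℝ → ℝ}
    (hc : Continuous c) : IntervalIntegrable (fun s => c s * g s) volume 0 1 :=
  hg.continuousOn_mul hc.continuousOn

lemma hasDerivAt_truncMoment_aux (hg : IntervalIntegrable g volume 0 1) (n : ℕ) (t : ℝ) :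
    HasDerivAt (truncMoment g (n + 1))
      (∫ s in (0 : ℝ)..1, if t < s then -((n + 1 : ℕ) : ℝ) * (s - t) ^ n * g s else 0) t := by
  refine (intervalIntegral.hasDerivAt_integral_of_dominated_loc_of_lip
    (bound := fun s => (n + 1 : ℕ) * (|t| + 2) ^ n * |g s|)
    (Metric.ball_mem_nhds t one_pos) ?_ ?_ ?_ ?_ ?_ ?_).2
  · exact Eventually.of_forall fun x =>
      (intervalIntegrable_mul_of_continuous hg (by fun_prop)).def'.aestronglyMeasurable
  · exact intervalIntegrable_mul_of_continuous hg (by fun_prop)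
  · have := (intervalIntegrable_mul_of_continuous hg
      (c := fun s => -((n + 1 : ℕ) : ℝ) * (s - t) ^ n) (by fun_prop)).def'.aestronglyMeasurable
    exact this.indicator (measurableSet_Ioi (a := t))
  · refine Eventually.of_forall fun s hs => ?_
    rw [uIoc_of_le zero_le_one] at hs
    rw [lipschitzOnWith_iff_dist_le_mul]
    intro x hx y hy
    have hb : ∀ z ∈ Metric.ball t 1, |max (s - z) 0| ≤ |t| + 2 := by
      intro z hz
      rw [Metric.mem_ball, Real.dist_eq, abs_lt] at hz
      rw [abs_of_nonneg (le_max_right _ _)]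
      refine max_le ?_ (by positivity)
      linarith [neg_abs_le t, hs.2]
    have h1 := abs_pow_sub_pow_le (max (s - x) 0) (max (s - y) 0) (n + 1)
    have h2 : |max (s - x) 0 - max (s - y) 0| ≤ |x - y| :=
      (abs_max_sub_max_le_abs _ _ _).trans_eq (by rw [abs_sub_comm]; ring_nf)
    have h3 : max |max (s - x) 0| |max (s - y) 0| ^ n ≤ (|t| + 2) ^ n :=
      pow_le_pow_left₀ ((abs_nonneg _).trans (le_max_left _ _)) (max_le (hb x hx) (hb y hy)) n
    rw [Real.coe_nnabs, Real.dist_eq, Real.dist_eq, ← sub_mul, abs_mul,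
      abs_of_nonneg (a := ((n + 1 : ℕ) : ℝ) * (|t| + 2) ^ n * |g s|) (by positivity)]
    calc |max (s - x) 0 ^ (n + 1) - max (s - y) 0 ^ (n + 1)| * |g s|
        ≤ (|x - y| * (n + 1 : ℕ) * (|t| + 2) ^ n) * |g s| := by
          gcongr
          refine h1.trans ?_
          rw [Nat.add_sub_cancel]
          gcongr
      _ = _ := by ring
  · exact hg.abs.const_mul _
  · have : ∀ᵐ s : ℝ, s ≠ t := by simp [ae_iff]
    filter_upwards [this] with s hs _
    rcases lt_or_gt_of_ne hs with h | h
    · rw [if_neg h.le.not_gt]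
      refine (hasDerivAt_const t (0 : ℝ)).congr_of_eventuallyEq ?_
      filter_upwards [lt_mem_nhds h] with x hx
      simp [max_eq_right (sub_nonpos.2 hx.le)]
    · rw [if_pos h]
      have hd : HasDerivAt (fun x : ℝ => (s - x) ^ (n + 1) * g s)
          (-((n + 1 : ℕ) : ℝ) * (s - t) ^ n * g s) t := by
        refine (((hasDerivAt_id t).const_sub s).pow (n + 1) |>.mul_const (g s)).congr_deriv ?_
        simp
        ring
      refine hd.congr_of_eventuallyEq ?_
      filter_upwards [gt_mem_nhds h] with x hx
      simp [max_eq_left (sub_nonneg.2 hx.le)]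

lemma hasDerivAt_truncMoment (hg : IntervalIntegrable g volume 0 1) (n : ℕ) (t : ℝ) :
    HasDerivAt (truncMoment g (n + 2)) (-((n + 2 : ℕ) : ℝ) * truncMoment g (n + 1) t) t := by
  convert hasDerivAt_truncMoment_aux hg (n + 1) t using 1
  rw [truncMoment, ← intervalIntegral.integral_const_mul]
  refine intervalIntegral.integral_congr fun s _ => ?_
  split_ifs with h
  · rw [max_eq_left (sub_nonneg.2 h.le)]; ring
  · rw [max_eq_right (sub_nonpos.2 (not_lt.1 h))]; simp

lemma hasDerivAt_truncMoment_one (hg : IntervalIntegrable g volume 0 1) (t : ℝ) :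
    HasDerivAt (truncMoment g 1) (-tailIntegral g t) t := by
  convert hasDerivAt_truncMoment_aux hg 0 t using 1
  rw [tailIntegral, ← intervalIntegral.integral_neg]
  refine intervalIntegral.integral_congr fun s _ => ?_
  split_ifs <;> simp

lemma continuous_tailIntegral (hg : IntervalIntegrable g volume 0 1) :
    Continuous (tailIntegral g) := by
  refine continuous_iff_continuousAt.2 fun t =>
    intervalIntegral.continuousAt_of_dominated_interval (bound := fun s => |g s|) ?_ ?_ hg.abs ?_
  · exact Eventually.of_forall fun x =>
      hg.def'.aestronglyMeasurable.indicator (measurableSet_Ioi (a := x))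
  · refine Eventually.of_forall fun x => Eventually.of_forall fun s _ => ?_
    split_ifs <;> simp
  · have : ∀ᵐ s : ℝ, s ≠ t := by simp [ae_iff]
    filter_upwards [this] with s hs _
    rcases lt_or_gt_of_ne hs with h | h
    · refine (continuousAt_const (y := (0 : ℝ))).congr ?_
      filter_upwards [lt_mem_nhds h] with x hx
      rw [if_neg hx.le.not_gt]
    · refine (continuousAt_const (y := g s)).congr ?_
      filter_upwards [gt_mem_nhds h] with x hx
      rw [if_pos hx]

lemma tailIntegral_eq (hg : IntervalIntegrable g volume 0 1) {t : ℝ}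
    (ht : t ∈ Icc (0 : ℝ) 1) : tailIntegral g t = ∫ s in t..1, g s := by
  have hi : IntervalIntegrable (fun s => if t < s then g s else 0) volume 0 1 := by
    rw [intervalIntegrable_iff] at hg ⊢
    exact hg.indicator (measurableSet_Ioi (a := t))
  have ht' : t ∈ uIcc (0 : ℝ) 1 := by rwa [uIcc_of_le zero_le_one]
  have e1 : ∫ s in (0 : ℝ)..t, (if t < s then g s else 0) = 0 := by
    refine intervalIntegral.integral_zero_ae (Eventually.of_forall fun s hs => ?_)
    rw [uIoc_of_le ht.1] at hs
    exact if_neg hs.2.not_gt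
  have e2 : ∫ s in t..1, (if t < s then g s else 0) = ∫ s in t..1, g s := by
    refine intervalIntegral.integral_congr_ae (Eventually.of_forall fun s hs => ?_)
    rw [uIoc_of_le ht.2] at hs
    exact if_pos hs.1
  rw [tailIntegral, ← intervalIntegral.integral_add_adjacent_intervals
    (hi.mono_set (uIcc_subset_uIcc_left ht')) (hi.mono_set (uIcc_subset_uIcc_right ht')),
    e1, e2, zero_add]

lemma kern_eq (t s : ℝ) :
    kern t s = (max (s - t) 0 ^ 3 - s ^ 3 + 3 * s ^ 2 * t) / 6 := by
  rw [kern]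
  split_ifs with h
  · rw [max_eq_left (sub_nonneg.2 h)]; ring
  · rw [max_eq_right (sub_nonpos.2 (not_le.1 h).le)]; ring

lemma integral_kern_mul (hg : IntervalIntegrable g volume 0 1) (t : ℝ) :
    ∫ s in (0 : ℝ)..1, kern t s * g s =
      (truncMoment g 3 t - truncMoment g 3 0 + 3 * truncMoment g 2 0 * t) / 6 := by
  have e : ∀ s ∈ uIcc (0 : ℝ) 1, kern t s * g s =
      (max (s - t) 0 ^ 3 * g s - max (s - 0) 0 ^ 3 * g s
        + 3 * t * (max (s - 0) 0 ^ 2 * g s)) / 6 := by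
    intro s hs
    rw [uIcc_of_le zero_le_one] at hs
    rw [kern_eq, sub_zero, max_eq_left hs.1]
    ring
  rw [intervalIntegral.integral_congr e, intervalIntegral.integral_div,
    intervalIntegral.integral_add, intervalIntegral.integral_sub,
    intervalIntegral.integral_const_mul, truncMoment, truncMoment, truncMoment]
  · ring
  · exact intervalIntegrable_mul_of_continuous hg (by fun_prop)
  · exact intervalIntegrable_mul_of_continuous hg (by fun_prop)
  · exact (intervalIntegrable_mul_of_continuous hg (by fun_prop)).sub
      (intervalIntegrable_mul_of_continuous hg (by fun_prop))
  · exact (intervalIntegrable_mul_of_continuous hg (by fun_prop)).const_mul _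

lemma exists_isJet3_green (hg : IntervalIntegrable g volume 0 1) (c : ℝ) :
    ∃ w₁ w₂ : ℝ → ℝ, IsJet3 (fun t => gam t * c + ∫ s in (0 : ℝ)..1, kern t s * g s) w₁ w₂
      (fun t => -c - tailIntegral g t) ∧
      gam 0 * c + (∫ s in (0 : ℝ)..1, kern 0 s * g s) = 0 ∧ w₁ 0 = 0 ∧ w₂ 1 = 0 := by
  refine ⟨fun t => (6 * t - 3 * t ^ 2) / 6 * c
      + (-3 * truncMoment g 2 t + 3 * truncMoment g 2 0) / 6,
    fun t => (1 - t) * c + truncMoment g 1 t,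
    ⟨fun t => ?_, fun t => ?_, fun t => ?_, ?_⟩, ?_, ?_, ?_⟩
  · simp only [integral_kern_mul hg]
    have hgam : HasDerivAt gam ((6 * t - 3 * t ^ 2) / 6) t := by
      refine ((((hasDerivAt_pow 2 t).const_mul 3).sub (hasDerivAt_pow 3 t)).div_const 6).congr_deriv
        ?_
      norm_num
      ring
    refine ((hgam.mul_const c).add ((((hasDerivAt_truncMoment hg 1 t).sub_const _).add
      ((hasDerivAt_id t).const_mul (3 * truncMoment g 2 0))).div_const 6)).congr_deriv ?_
    norm_num
  · refine ((((((hasDerivAt_id t).const_mul 6).sub ((hasDerivAt_pow 2 t).const_mul 3)).div_const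
      6).mul_const c).add ((((hasDerivAt_truncMoment hg 0 t).const_mul (-3)).add_const
      (3 * truncMoment g 2 0)).div_const 6)).congr_deriv ?_
    norm_num
    ring
  · refine ((((hasDerivAt_id t).const_sub 1).mul_const c).add
      (hasDerivAt_truncMoment_one hg t)).congr_deriv ?_
    ring
  · exact continuous_const.sub (continuous_tailIntegral hg)
  · simp [integral_kern_mul hg, gam]
  · simp
  · have : truncMoment g 1 1 = ∫ s in (0 : ℝ)..1, (0 : ℝ) := by
      refine intervalIntegral.integral_congr fun s hs => ?_
      rw [uIcc_of_le zero_le_one] at hs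
      simp [max_eq_right (sub_nonpos.2 hs.2)]
    simp [this]

end Kernel

/-- The point `(s, u(s), u'(s), u''(s), u'''(s))`. -/
noncomputable def jetPoint (u : ℝ → ℝ) (s : ℝ) : ℝ × ℝ × ℝ × ℝ × ℝ :=
  (s, u s, deriv u s, deriv^[2] u s, deriv^[3] u s)

section Superposition

variable {ρ : ℝ} {f : ℝ × ℝ × ℝ × ℝ × ℝ → ℝ} {u v : ℝ → ℝ}

lemma continuous_jetPoint (hu : ContDiff ℝ 3 u) : Continuous (jetPoint u) := by
  have h := isJet3_of_contDiff hu
  have c1 : Continuous (deriv u) := continuous_iff_continuousAt.2 fun t => (h.2.1 t).continuousAt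
  have c2 : Continuous (deriv^[2] u) :=
    continuous_iff_continuousAt.2 fun t => (h.2.2.1 t).continuousAt
  exact continuous_id.prodMk (hu.continuous.prodMk (c1.prodMk (c2.prodMk h.2.2.2)))

lemma jetPoint_mem_PiSet (hu : u ∈ Kbar ρ) {s : ℝ} (hs : s ∈ Icc (0 : ℝ) 1) :
    jetPoint u s ∈ PiSet ρ := by
  obtain ⟨⟨hc, hpos⟩, hn⟩ := hu
  obtain ⟨p0, p1, p2, p3⟩ := hpos s hs
  obtain ⟨b0, b1, b2, b3⟩ := (isJet3_of_contDiff hc).abs_le_norm3 hs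
  exact ⟨hs, ⟨p0, (le_of_abs_le b0).trans hn⟩, ⟨p1, (le_of_abs_le b1).trans hn⟩,
    ⟨p2, (le_of_abs_le b2).trans hn⟩,
    ⟨(neg_le_neg hn).trans (neg_le_of_abs_le b3), neg_nonneg.1 p3⟩⟩

lemma dist_jetPoint_le (hu : ContDiff ℝ 3 u) (hv : ContDiff ℝ 3 v) {s : ℝ}
    (hs : s ∈ Icc (0 : ℝ) 1) : dist (jetPoint u s) (jetPoint v s) ≤ norm3 (u - v) := by
  obtain ⟨b0, b1, b2, b3⟩ :=
    ((isJet3_of_contDiff hu).sub (isJet3_of_contDiff hv)).abs_le_norm3 hs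
  simp only [jetPoint, Prod.dist_eq, Real.dist_eq, sub_self, abs_zero]
  exact max_le (norm3_nonneg _) (max_le b0 (max_le b1 (max_le b2 b3)))

lemma isCompact_PiSet (ρ : ℝ) : IsCompact (PiSet ρ) := by
  have : PiSet ρ = Icc (0 : ℝ) 1 ×ˢ Icc 0 ρ ×ˢ Icc 0 ρ ×ˢ Icc 0 ρ ×ˢ Icc (-ρ) 0 := rfl
  rw [this]
  exact isCompact_Icc.prod (isCompact_Icc.prod (isCompact_Icc.prod
    (isCompact_Icc.prod isCompact_Icc)))

lemma intervalIntegrable_superposition (hf : ContinuousOn f (PiSet ρ)) (hu : u ∈ Kbar ρ) :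
    IntervalIntegrable (fun s => f (jetPoint u s)) volume 0 1 := by
  refine ContinuousOn.intervalIntegrable ?_
  rw [uIcc_of_le zero_le_one]
  exact hf.comp (continuous_jetPoint hu.1.1).continuousOn fun s hs => jetPoint_mem_PiSet hu hs

lemma exists_isJet3_Toper (hf : ContinuousOn f (PiSet ρ)) (H : (ℝ → ℝ) → ℝ) (hu : u ∈ Kbar ρ) :
    ∃ w₁ w₂ : ℝ → ℝ, IsJet3 (Toper f H u) w₁ w₂
      (fun t => -H u - tailIntegral (fun s => f (jetPoint u s)) t) ∧
      Toper f H u 0 = 0 ∧ w₁ 0 = 0 ∧ w₂ 1 = 0 :=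
  exists_isJet3_green (intervalIntegrable_superposition hf hu) (H u)

lemma tailIntegral_nonneg {g : ℝ → ℝ} (hg : ∀ s ∈ Icc (0 : ℝ) 1, 0 ≤ g s) (t : ℝ) :
    0 ≤ tailIntegral g t := by
  refine intervalIntegral.integral_nonneg zero_le_one fun s hs => ?_
  split_ifs
  exacts [hg s hs, le_rfl]

lemma abs_intervalIntegral_le {g : ℝ → ℝ} {C a b : ℝ} (ha : a ∈ Icc (0 : ℝ) 1)
    (hb : b ∈ Icc (0 : ℝ) 1) (hg : ∀ s ∈ Icc (0 : ℝ) 1, |g s| ≤ C) :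
    |∫ s in a..b, g s| ≤ C * |b - a| := by
  rw [← Real.norm_eq_abs]
  exact intervalIntegral.norm_integral_le_of_norm_le_const fun s hs =>
    hg s (uIcc_subset_Icc ha hb (uIoc_subset_uIcc hs))

lemma abs_tailIntegral_le {g : ℝ → ℝ} (hg : IntervalIntegrable g volume 0 1) {C : ℝ}
    (hC : ∀ s ∈ Icc (0 : ℝ) 1, |g s| ≤ C) {t : ℝ} (ht : t ∈ Icc (0 : ℝ) 1) :
    |tailIntegral g t| ≤ C := by
  rw [tailIntegral_eq hg ht]
  refine (abs_intervalIntegral_le ht (by simp) hC).trans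
    (mul_le_of_le_one_right ((abs_nonneg _).trans (hC t ht)) ?_)
  rw [abs_le]
  constructor <;> linarith [ht.1, ht.2]

lemma tailIntegral_sub_tailIntegral {g₁ g₂ : ℝ → ℝ} (h₁ : IntervalIntegrable g₁ volume 0 1)
    (h₂ : IntervalIntegrable g₂ volume 0 1) {t : ℝ} (ht : t ∈ Icc (0 : ℝ) 1) :
    tailIntegral g₁ t - tailIntegral g₂ t = tailIntegral (fun s => g₁ s - g₂ s) t := by
  have ht' : t ∈ uIcc (0 : ℝ) 1 := by rwa [uIcc_of_le zero_le_one]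
  rw [tailIntegral_eq h₁ ht, tailIntegral_eq h₂ ht, tailIntegral_eq (h₁.sub h₂) ht,
    intervalIntegral.integral_sub (h₁.mono_set (uIcc_subset_uIcc_right ht'))
      (h₂.mono_set (uIcc_subset_uIcc_right ht'))]

lemma abs_tailIntegral_sub_le {g : ℝ → ℝ} (hg : IntervalIntegrable g volume 0 1) {C : ℝ}
    (hC : ∀ s ∈ Icc (0 : ℝ) 1, |g s| ≤ C) {x y : ℝ} (hx : x ∈ Icc (0 : ℝ) 1)
    (hy : y ∈ Icc (0 : ℝ) 1) : |tailIntegral g x - tailIntegral g y| ≤ C * |x - y| := by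
  have hx' : x ∈ uIcc (0 : ℝ) 1 := by rwa [uIcc_of_le zero_le_one]
  have hy' : y ∈ uIcc (0 : ℝ) 1 := by rwa [uIcc_of_le zero_le_one]
  rw [tailIntegral_eq hg hx, tailIntegral_eq hg hy,
    ← intervalIntegral.integral_add_adjacent_intervals (hg.mono_set (uIcc_subset_uIcc hx' hy'))
      (hg.mono_set (uIcc_subset_uIcc_right hy')), add_sub_cancel_right, abs_sub_comm x]
  exact abs_intervalIntegral_le hx hy hC

end Superposition

/-- Arzelà–Ascoli on `[0,1]` for uniformly bounded, uniformly Lipschitz sequences. -/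
lemma exists_subseq_tendsto_uniformly {h : ℕ → ℝ → ℝ} (hc : ∀ n, Continuous (h n)) {B C : ℝ}
    (hB : ∀ n, ∀ t ∈ Icc (0 : ℝ) 1, |h n t| ≤ B)
    (hC : ∀ n, ∀ x ∈ Icc (0 : ℝ) 1, ∀ y ∈ Icc (0 : ℝ) 1, |h n x - h n y| ≤ C * |x - y|) :
    ∃ φ : ℕ → ℕ, StrictMono φ ∧ ∃ k : ℝ → ℝ, Continuous k ∧ ∃ e : ℕ → ℝ,
      Tendsto e atTop (𝓝 0) ∧ ∀ n, ∀ t ∈ Icc (0 : ℝ) 1, |h (φ n) t - k t| ≤ e n := by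
  let F : ℕ → BoundedContinuousFunction (Icc (0 : ℝ) 1) ℝ := fun n =>
    BoundedContinuousFunction.mkOfCompact ⟨fun t => h n t, (hc n).comp continuous_subtype_val⟩
  have hK : IsCompact (closure (range F)) := by
    refine BoundedContinuousFunction.arzela_ascoli (Icc (-B) B) isCompact_Icc _ ?_ ?_
    · rintro _ t ⟨n, rfl⟩
      exact abs_le.1 (hB n t t.2)
    · refine Metric.equicontinuous_of_continuity_modulus (fun r => C * r) ?_ _ ?_
      · simpa using (continuous_const_mul C).tendsto 0
      · rintro x y ⟨_, n, rfl⟩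
        exact hC n x x.2 y y.2
  obtain ⟨k, -, φ, hφ, hlim⟩ := hK.tendsto_subseq fun n => subset_closure (mem_range_self n)
  refine ⟨φ, hφ, IccExtend zero_le_one k, k.continuous.Icc_extend', fun n => dist (F (φ n)) k,
    tendsto_iff_dist_tendsto_zero.1 hlim, fun n t ht => ?_⟩
  rw [IccExtend_of_mem _ _ ht]
  exact BoundedContinuousFunction.dist_coe_le_dist (f := F (φ n)) (g := k) ⟨t, ht⟩

/-- If `f ≥ 0` is continuous on `Π_ρ` and `H` is a continuous bounded non-negative
functional on `K̄_ρ`, then `T` maps `K̄_ρ` into `K` and `T : K̄_ρ → K` is compact: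
continuous (w.r.t. `‖·‖₃`) and with relatively compact image (every sequence in the
image has a subsequence converging in `‖·‖₃` to an element of `C³[0,1]`). -/
theorem Top_maps_into_cone_and_is_compact
    (ρ : ℝ) (hρ : 0 < ρ)
    (f : ℝ × ℝ × ℝ × ℝ × ℝ → ℝ) (hfc : ContinuousOn f (PiSet ρ))
    (hf0 : ∀ p ∈ PiSet ρ, 0 ≤ f p)
    (H : (ℝ → ℝ) → ℝ) (hHc : ContOn3 H (Kbar ρ)) (hHb : BddOn3 H (Kbar ρ))
    (hH0 : ∀ u ∈ Kbar ρ, 0 ≤ H u) :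
    (∀ u ∈ Kbar ρ, Toper f H u ∈ coneK) ∧
    (∀ u ∈ Kbar ρ, ∀ ε > (0:ℝ), ∃ δ > (0:ℝ), ∀ v ∈ Kbar ρ,
      norm3 (u - v) < δ → norm3 (Toper f H u - Toper f H v) < ε) ∧
    (∀ u : ℕ → ℝ → ℝ, (∀ n, u n ∈ Kbar ρ) →
      ∃ φ : ℕ → ℕ, StrictMono φ ∧ ∃ v : ℝ → ℝ, ContDiff ℝ 3 v ∧
        Tendsto (fun n => norm3 (Toper f H (u (φ n)) - v)) atTop (𝓝 0)) := by
  have hfi := fun {u : ℝ → ℝ} (hu : u ∈ Kbar ρ) => intervalIntegrable_superposition hfc hu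
  refine ⟨fun u hu => ?_, fun u hu ε hε => ?_, fun u hu => ?_⟩
  · obtain ⟨w₁, w₂, hj, e0, e1, e2⟩ := exists_isJet3_Toper hfc H hu
    refine hj.mem_coneK e0 e1 e2 fun t _ => ?_
    have := tailIntegral_nonneg (fun s hs => hf0 _ (jetPoint_mem_PiSet hu hs)) t
    linarith [hH0 u hu]
  · obtain ⟨δ₁, hδ₁, hH⟩ := hHc u hu (ε / 3) (by positivity)
    obtain ⟨δ₂, hδ₂, hF⟩ := Metric.uniformContinuousOn_iff.1
      ((isCompact_PiSet ρ).uniformContinuousOn_of_continuous hfc) (ε / 3) (by positivity)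
    refine ⟨min δ₁ δ₂, lt_min hδ₁ hδ₂, fun v hv huv => ?_⟩
    obtain ⟨w₁, w₂, hj, e0, e1, e2⟩ := exists_isJet3_Toper hfc H hu
    obtain ⟨z₁, z₂, hj', e0', e1', e2'⟩ := exists_isJet3_Toper hfc H hv
    refine ((hj.sub hj').norm3_le (C := ε / 3 + ε / 3) (by simp [e0, e0']) (by simp [e1, e1'])
      (by simp [e2, e2']) fun t ht => ?_).trans_lt (by linarith)
    have h1 := hH v hv (huv.trans_le (min_le_left _ _))
    have h2 : |tailIntegral (fun s => f (jetPoint u s) - f (jetPoint v s)) t| ≤ ε / 3 :=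
      abs_tailIntegral_le ((hfi hu).sub (hfi hv)) (fun s hs => (hF _ (jetPoint_mem_PiSet hu hs) _
        (jetPoint_mem_PiSet hv hs) ((dist_jetPoint_le hu.1.1 hv.1.1 hs).trans_lt
          (huv.trans_le (min_le_right _ _)))).le) ht
    rw [← tailIntegral_sub_tailIntegral (hfi hu) (hfi hv) ht] at h2
    rw [Pi.sub_apply]
    rw [abs_lt] at h1
    rw [abs_le] at h2 ⊢
    constructor <;> linarith [h1.1, h1.2, h2.1, h2.2]
  · obtain ⟨M, hM⟩ := hHb
    obtain ⟨C, hC⟩ := (isCompact_PiSet ρ).exists_bound_of_continuousOn hfc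
    have hfC : ∀ n, ∀ s ∈ Icc (0 : ℝ) 1, |f (jetPoint (u n) s)| ≤ C := fun n s hs =>
      hC _ (jetPoint_mem_PiSet (hu n) hs)
    choose w₁ w₂ hj e0 e1 e2 using fun n => exists_isJet3_Toper hfc H (hu n)
    obtain ⟨φ, hφ, k, hk, e, he, hle⟩ :=
      exists_subseq_tendsto_uniformly (B := M + C) (C := C) (fun n => (hj n).2.2.2)
        (fun n t ht => by
          have h1 := abs_le.1 (hM _ (hu n))
          have h2 := abs_le.1 (abs_tailIntegral_le (hfi (hu n)) (hfC n) ht)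
          rw [abs_le]
          constructor <;> linarith [h1.1, h1.2, h2.1, h2.2])
        (fun n x hx y hy => by
          rw [sub_sub_sub_cancel_left, abs_sub_comm]
          exact abs_tailIntegral_sub_le (hfi (hu n)) (hfC n) hx hy)
    obtain ⟨v, v₁, v₂, hv, z0, z1, z2⟩ := exists_isJet3_of_continuous hk
    refine ⟨φ, hφ, v, hv.contDiff, squeeze_zero (fun n => norm3_nonneg _) (fun n => ?_) he⟩
    exact ((hj (φ n)).sub hv).norm3_le (by simp [e0, z0]) (by simp [e1, z1]) (by simp [e2, z2])
      (hle n)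
end
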